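/- arXiv:2505.06717 — 2 statements merged into one kernel-verified Lean document; each statement's English description precedes it below -/
import Mathlib

section
/- For every odd n ≥ 3, there exists an unsolvable SR instance with n agents that admits a stable partition containing exactly 1 cycle of odd length (a cycle of length 3). -/
/-- An SR instance with `n` agents. `rank i j` is the position (starting at 1) of
agent `j` in agent `i`'s preference list; by convention `rank i i = n`, encoding
that an agent prefers every other agent to itself. -/
structure SRInstance (n : ℕ) where
  rank : Fin n → Fin n → ℕ
  rank_self : ∀ i, rank i i = n
  rank_bijOn : ∀ i, Set.BijOn (rank i) {j | j ≠ i} (Set.Icc 1 (n - 1))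

variable {n : ℕ}

/-- `M` is a matching, encoded as an involution; `M i = i` means `i` is unmatched. -/
def IsMatching (M : Fin n → Fin n) : Prop := ∀ i, M (M i) = i

/-- The pair `{i, j}` blocks the matching `M`. -/
def Blocks (I : SRInstance n) (M : Fin n → Fin n) (i j : Fin n) : Prop :=
  i ≠ j ∧ (M i = i ∨ I.rank i j < I.rank i (M i)) ∧ (M j = j ∨ I.rank j i < I.rank j (M j))

def IsStableMatching (I : SRInstance n) (M : Fin n → Fin n) : Prop :=
  IsMatching M ∧ ∀ i j, ¬ Blocks I M i j

def Solvable (I : SRInstance n) : Prop := ∃ M, IsStableMatching I M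

/-- A stable partition: (T1) every agent weakly prefers its successor to its
predecessor, and (T2) no two distinct agents each strictly prefer the other to
their respective predecessors. -/
def IsStablePartition (I : SRInstance n) (σ : Equiv.Perm (Fin n)) : Prop :=
  (∀ a, I.rank a (σ a) ≤ I.rank a (σ⁻¹ a)) ∧
  ¬ ∃ i j : Fin n, i ≠ j ∧ I.rank i j < I.rank i (σ⁻¹ i) ∧ I.rank j i < I.rank j (σ⁻¹ j)

/-- The orbit (cycle) of `σ` containing `a`, as a finset. -/
def orbitOf (σ : Equiv.Perm (Fin n)) (a : Fin n) : Finset (Fin n) :=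
  Finset.univ.filter (fun b => σ.SameCycle a b)

/-- The number of cycles of odd length of the permutation `σ`. -/
def oddCycleCount (σ : Equiv.Perm (Fin n)) : ℕ :=
  ((Finset.univ.image (fun a => orbitOf σ a)).filter (fun s => Odd s.card)).card

/-- The cycle of `σ` at `a`, recorded as its orbit together with the cyclic
permutation induced on it (identity off the orbit). -/
def cycleAt (σ : Equiv.Perm (Fin n)) (a : Fin n) : Finset (Fin n) × Equiv.Perm (Fin n) :=
  (orbitOf σ a, σ.cycleOf a)

/-- The stable cycles of `I`: cycles occurring in some stable partition of `I`. -/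
def stableCycles (I : SRInstance n) : Set (Finset (Fin n) × Equiv.Perm (Fin n)) :=
  {c | ∃ (σ : Equiv.Perm (Fin n)) (a : Fin n), IsStablePartition I σ ∧ cycleAt σ a = c}

/-- The reduced stable cycles of `I`: stable cycles of length 2 or of odd length. -/
def reducedStableCycles (I : SRInstance n) : Set (Finset (Fin n) × Equiv.Perm (Fin n)) :=
  {c | c ∈ stableCycles I ∧ (c.1.card = 2 ∨ Odd c.1.card)}

/-- Three distinct points can be moved to three distinct points by a permutation. -/
theorem exists_perm_apply_eq_three {α : Type*} {a b c x y z : α} (hab : a ≠ b) (hac : a ≠ c)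
    (hbc : b ≠ c) (hxy : x ≠ y) (hxz : x ≠ z) (hyz : y ≠ z) :
    ∃ p : Equiv.Perm α, p a = x ∧ p b = y ∧ p c = z := by
  have inj : ∀ u v w : α, u ≠ v → u ≠ w → v ≠ w → Function.Injective ![u, v, w] := by
    intro u v w h1 h2 h3 i j hij
    fin_cases i <;> fin_cases j <;> simp_all
  have := Equiv.Perm.isMultiplyPretransitive α 3
  obtain ⟨g, hg⟩ := MulAction.exists_smul_eq (Equiv.Perm α)
    (⟨_, inj a b c hab hac hbc⟩ : Fin 3 ↪ α) ⟨_, inj x y z hxy hxz hyz⟩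
  exact ⟨g, by simpa using DFunLike.congr_fun hg 0, by simpa using DFunLike.congr_fun hg 1,
    by simpa using DFunLike.congr_fun hg 2⟩

/-- For a permutation `σ` without fixed points there is an instance in which every agent ranks
its successor first and, if different, its predecessor second. -/
theorem SRInstance.exists_rank_eq (h3 : 3 ≤ n) (σ : Equiv.Perm (Fin n)) (hσ : ∀ i, σ i ≠ i) :
    ∃ I : SRInstance n, (∀ i, I.rank i (σ i) = 1) ∧
      ∀ i, σ⁻¹ i ≠ σ i → I.rank i (σ⁻¹ i) = 2 := by
  have key : ∀ i, ∃ p : Equiv.Perm (Fin n), (p i : ℕ) = n - 1 ∧ (p (σ i) : ℕ) = 0 ∧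
      (σ⁻¹ i ≠ σ i → (p (σ⁻¹ i) : ℕ) = 1) := by
    intro i
    obtain ⟨c, hci, hcσ, hc⟩ : ∃ c, i ≠ c ∧ σ i ≠ c ∧ (σ⁻¹ i ≠ σ i → σ⁻¹ i = c) := by
      by_cases h : σ⁻¹ i = σ i
      · obtain ⟨c, hc⟩ := Finset.exists_mem_notMem_of_card_lt_card
          (s := {i, σ i}) (t := (Finset.univ : Finset (Fin n)))
          (Finset.card_le_two.trans_lt (by simp; omega))
        simp only [Finset.mem_univ, Finset.mem_insert, Finset.mem_singleton, not_or,
          true_and] at hc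
        exact ⟨c, Ne.symm hc.1, Ne.symm hc.2, fun h' => absurd h h'⟩
      · refine ⟨σ⁻¹ i, fun h' => hσ i ?_, Ne.symm h, fun _ => rfl⟩
        exact (Equiv.Perm.eq_inv_iff_eq.mp h')
    obtain ⟨p, h1, h2, h4⟩ := exists_perm_apply_eq_three (hσ i).symm hci hcσ
      (x := (⟨n - 1, by omega⟩ : Fin n)) (y := ⟨0, by omega⟩) (z := ⟨1, by omega⟩)
      (by simp; omega) (by simp; omega) (by simp)
    exact ⟨p, by rw [h1], by rw [h2], fun h => by rw [hc h, h4]⟩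
  choose p h1 h2 h4 using key
  refine ⟨⟨fun i j => p i j + 1, fun i => by rw [h1]; omega, fun i => ⟨?_, ?_, ?_⟩⟩,
    fun i => by simp [h2], fun i h => congrArg (· + 1) (h4 i h)⟩
  · intro j hj
    have : (p i j : ℕ) ≠ p i i := fun h => hj ((p i).injective (Fin.ext h))
    have := (p i j).isLt
    have := h1 i
    simp only [Set.mem_Icc]
    omega
  · intro j _ k _ h
    exact (p i).injective (Fin.ext (by simpa using h))
  · intro k hk
    simp only [Set.mem_Icc] at hk
    refine ⟨(p i).symm ⟨k - 1, by omega⟩, fun h => ?_, ?_⟩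
    · have := h1 i
      rw [← (Equiv.symm_apply_eq _).mp h] at this
      dsimp only at this
      omega
    · simp only [Equiv.apply_symm_apply]
      omega

theorem SRInstance.one_le_rank (I : SRInstance n) (i j : Fin n) : 1 ≤ I.rank i j := by
  by_cases h : j = i
  · subst h
    rw [I.rank_self]
    exact j.pos
  · exact ((I.rank_bijOn i).mapsTo h).1

/-- If every agent is the first choice of some other agent, no agent is unmatched in a stable
matching, so there is no stable matching when the number of agents is odd. -/
theorem not_solvable_of_rank_eq_one (hn : Odd n) (I : SRInstance n) (σ : Equiv.Perm (Fin n))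
    (hσ : ∀ i, σ i ≠ i) (h1 : ∀ i, I.rank i (σ i) = 1) : ¬ Solvable I := by
  rintro ⟨M, hM, hst⟩
  obtain ⟨i, hi⟩ : ∃ i, M i = i := by
    have : Fact (Nat.Prime 2) := ⟨Nat.prime_two⟩
    refine Equiv.Perm.exists_fixed_point_of_prime (p := 2) (n := 1)
      (σ := Function.Involutive.toPerm M hM) ?_ ?_
    · simpa using hn.not_two_dvd_nat
    · ext x
      rw [pow_one, pow_two]
      exact congrArg Fin.val (hM x)
  obtain ⟨j, rfl⟩ := σ.surjective i
  refine hst j (σ j) ⟨(hσ j).symm, ?_, Or.inl hi⟩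
  by_contra! h
  obtain ⟨hj, hr⟩ := h
  rw [h1] at hr
  have := I.one_le_rank j (M j)
  have hMj : M j = σ j := (I.rank_bijOn j).injOn hj (hσ j) (by rw [h1]; omega)
  rw [← hMj, hM] at hi
  exact hj hi.symm

theorem isStablePartition_of_rank_eq (I : SRInstance n) (σ : Equiv.Perm (Fin n))
    (hσ : ∀ i, σ i ≠ i) (h1 : ∀ i, I.rank i (σ i) = 1)
    (h2 : ∀ i, σ⁻¹ i ≠ σ i → I.rank i (σ⁻¹ i) = 2) : IsStablePartition I σ := by
  refine ⟨fun a => (h1 a).trans_le (I.one_le_rank _ _), ?_⟩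
  have key : ∀ i j, i ≠ j → I.rank i j < I.rank i (σ⁻¹ i) → j = σ i ∧ σ⁻¹ i ≠ σ i := by
    intro i j hij h
    have hpos := I.one_le_rank i j
    have hne : σ⁻¹ i ≠ σ i := fun h' => by
      rw [h', h1] at h
      omega
    rw [h2 i hne] at h
    exact ⟨(I.rank_bijOn i).injOn hij.symm (hσ i) (by rw [h1]; omega), hne⟩
  rintro ⟨i, j, hij, hi, hj⟩
  obtain ⟨h, hne⟩ := key i j hij hi
  obtain ⟨h', -⟩ := key j i hij.symm hj
  exact hne (by rw [Equiv.Perm.inv_eq_iff_eq, ← h, ← h'])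

theorem orbitOf_subset (σ : Equiv.Perm (Fin n)) {a : Fin n} {s : Finset (Fin n)} (ha : a ∈ s)
    (hs : ∀ x ∈ s, σ x ∈ s) : orbitOf σ a ⊆ s := by
  intro b hb
  simp only [orbitOf, Finset.mem_filter, Finset.mem_univ, true_and] at hb
  obtain ⟨k, -, rfl⟩ := hb.exists_pow_eq'
  clear hb
  induction k with
  | zero => simpa
  | succ k ih =>
    rw [pow_succ', Equiv.Perm.mul_apply]
    exact hs _ ih

theorem mem_orbitOf_self (σ : Equiv.Perm (Fin n)) (a : Fin n) : a ∈ orbitOf σ a := by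
  simp [orbitOf, Equiv.Perm.SameCycle.refl]

theorem apply_mem_orbitOf (σ : Equiv.Perm (Fin n)) {a b : Fin n} (h : b ∈ orbitOf σ a) :
    σ b ∈ orbitOf σ a := by
  simpa [orbitOf] using h

theorem card_orbitOf_eq_two (σ : Equiv.Perm (Fin n)) {a : Fin n} (h1 : σ a ≠ a)
    (h2 : σ (σ a) = a) : (orbitOf σ a).card = 2 := by
  have : orbitOf σ a = {a, σ a} := by
    refine (orbitOf_subset σ (by simp) ?_).antisymm ?_
    · simp [h2]
    · simp [Finset.insert_subset_iff, mem_orbitOf_self, apply_mem_orbitOf]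
  rw [this, Finset.card_pair h1.symm]

theorem orbitOf_eq_triple (σ : Equiv.Perm (Fin n)) {a : Fin n} (h : σ (σ (σ a)) = a) :
    orbitOf σ a = {a, σ a, σ (σ a)} := by
  refine (orbitOf_subset σ (by simp) ?_).antisymm ?_
  · simp [h]
  · simp [Finset.insert_subset_iff, mem_orbitOf_self, apply_mem_orbitOf]

theorem orbitOf_eq_of_mem (σ : Equiv.Perm (Fin n)) {a b : Fin n} (h : b ∈ orbitOf σ a) :
    orbitOf σ b = orbitOf σ a := by
  simp only [orbitOf, Finset.mem_filter, Finset.mem_univ, true_and] at h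
  ext c
  simp only [orbitOf, Finset.mem_filter, Finset.mem_univ, true_and]
  exact ⟨h.trans, h.symm.trans⟩

/-- For odd `n ≥ 3`, the permutation `(0 1 2)(3 4)(5 6)⋯` of `Fin n`. -/
def triangleAndPairs (hn : Odd n) (h3 : 3 ≤ n) : Equiv.Perm (Fin n) where
  toFun i := ⟨if i.1 = 2 then 0 else if i.1 < 2 then i + 1 else
    if i.1 % 2 = 1 then i + 1 else i - 1, by obtain ⟨k, hk⟩ := hn; grind⟩
  invFun i := ⟨if i.1 = 0 then 2 else if i.1 < 3 then i - 1 else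
    if i.1 % 2 = 1 then i + 1 else i - 1, by obtain ⟨k, hk⟩ := hn; grind⟩
  left_inv i := by ext; grind
  right_inv i := by ext; grind

theorem triangleAndPairs_apply_val (hn : Odd n) (h3 : 3 ≤ n) (i : Fin n) :
    (triangleAndPairs hn h3 i : ℕ) = if i.1 = 2 then 0 else if i.1 < 2 then i.1 + 1 else
      if i.1 % 2 = 1 then i.1 + 1 else i.1 - 1 := rfl

/-- For every odd `n ≥ 3` there is an unsolvable SR instance with
`n` agents that admits a stable partition with exactly 1 odd cycle, which is a
cycle of length 3. -/
theorem exists_unsolvable_odd_one_odd_cycle (n : ℕ) (hn : Odd n) (h3 : 3 ≤ n) :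
    ∃ I : SRInstance n, ¬ Solvable I ∧
      ∃ σ : Equiv.Perm (Fin n), IsStablePartition I σ ∧ oddCycleCount σ = 1 ∧
        ∃ a : Fin n, Odd (orbitOf σ a).card ∧ (orbitOf σ a).card = 3 := by
  set σ := triangleAndPairs hn h3
  have hval : ∀ i, (σ i : ℕ) = _ := triangleAndPairs_apply_val hn h3
  have hσ : ∀ i, σ i ≠ i := fun i h => by
    have h' := congrArg Fin.val h
    rw [hval] at h'
    grind
  have hpair : ∀ i : Fin n, 3 ≤ i.1 → σ (σ i) = i := fun i hi => by
    ext
    rw [hval, hval]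
    grind
  have h01 : (σ ⟨0, by omega⟩) = ⟨1, by omega⟩ := by ext; rw [hval]; simp
  have h12 : (σ ⟨1, by omega⟩) = ⟨2, by omega⟩ := by ext; rw [hval]; simp
  have h20 : (σ ⟨2, by omega⟩) = ⟨0, by omega⟩ := by ext; rw [hval]; simp
  have horb : orbitOf σ ⟨0, by omega⟩ = {⟨0, by omega⟩, ⟨1, by omega⟩, ⟨2, by omega⟩} := by
    rw [orbitOf_eq_triple σ (by rw [h01, h12, h20]), h01, h12]
  have hcard : (orbitOf σ ⟨0, by omega⟩).card = 3 := by
    rw [horb, Finset.card_eq_three]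
    exact ⟨_, _, _, by simp, by simp, by simp, rfl⟩
  obtain ⟨I, h1, h2⟩ := SRInstance.exists_rank_eq h3 σ hσ
  refine ⟨I, not_solvable_of_rank_eq_one hn I σ hσ h1, σ,
    isStablePartition_of_rank_eq I σ hσ h1 h2, ?_, ⟨0, by omega⟩, ?_, hcard⟩
  · rw [oddCycleCount, Finset.card_eq_one]
    refine ⟨orbitOf σ ⟨0, by omega⟩, ?_⟩
    ext s
    simp only [Finset.mem_filter, Finset.mem_image, Finset.mem_univ, true_and,
      Finset.mem_singleton]
    constructor
    · rintro ⟨⟨a, rfl⟩, hodd⟩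
      by_cases ha : 3 ≤ a.1
      · rw [card_orbitOf_eq_two σ (hσ a) (hpair a ha)] at hodd
        exact absurd hodd (by decide)
      · refine orbitOf_eq_of_mem σ ?_
        rw [horb]
        simp only [Finset.mem_insert, Finset.mem_singleton, Fin.ext_iff]
        omega
    · rintro rfl
      exact ⟨⟨_, rfl⟩, by rw [hcard]; decide⟩
  · rw [hcard]
    decide
end

section
/- Let I be an SR instance with n ≥ 2 agents and let SC(I) denote the set of its stable cycles. Then |SC(I)| ≤ 3·(n(n−1)/2 + 1); in particular, the number of stable cycles of an SR instance with n agents is O(n²). -/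
variable {n : ℕ}

namespace SRInstance

variable (I : SRInstance n) {σ τ : Equiv.Perm (Fin n)}

lemma rank_lt_of_ne {i j : Fin n} (h : j ≠ i) : I.rank i j < n := by
  have h1 := ((I.rank_bijOn i).mapsTo h).2
  have := i.isLt
  omega

lemma rank_le (i j : Fin n) : I.rank i j ≤ n := by
  rcases eq_or_ne j i with rfl | h
  · exact (I.rank_self j).le
  · exact (I.rank_lt_of_ne h).le

lemma rank_injective (i : Fin n) : Function.Injective (I.rank i) := by
  intro j k h
  have hi := I.rank_self i
  rcases eq_or_ne j i with rfl | hj <;> rcases eq_or_ne k j with rfl | hk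
  · rfl
  · have := I.rank_lt_of_ne hk
    omega
  · rfl
  · rcases eq_or_ne k i with rfl | hki
    · have := I.rank_lt_of_ne hj
      omega
    · exact (I.rank_bijOn i).injOn hj hki h

variable {I}

lemma rank_pred_le_of_lt (hσ : IsStablePartition I σ) {i j : Fin n}
    (h : I.rank i j < I.rank i (σ⁻¹ i)) : I.rank j (σ⁻¹ j) ≤ I.rank j i := by
  by_contra! h'
  refine hσ.2 ⟨i, j, ?_, h, h'⟩
  rintro rfl
  have := I.rank_self i
  have := I.rank_le i (σ⁻¹ i)
  omega

variable (I) in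
/-- Agent `x` weakly prefers its predecessor in `σ` to its successor in `τ`. -/
def PredLeSucc (σ τ : Equiv.Perm (Fin n)) (x : Fin n) : Prop :=
  I.rank x (σ⁻¹ x) ≤ I.rank x (τ x)

lemma PredLeSucc.inv_apply (hτ : IsStablePartition I τ) {x : Fin n}
    (h : I.PredLeSucc σ τ x) : I.PredLeSucc τ σ (σ⁻¹ x) := by
  simp only [PredLeSucc, Equiv.Perm.inv_def, Equiv.apply_symm_apply] at h ⊢
  rcases h.lt_or_eq with h | h
  · exact rank_pred_le_of_lt hτ (h.trans_le (hτ.1 x))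
  · rw [I.rank_injective x h]
    simp

lemma PredLeSucc.mul_apply (hσ : IsStablePartition I σ) (hτ : IsStablePartition I τ) {x : Fin n}
    (h : I.PredLeSucc σ τ x) : I.PredLeSucc σ τ ((σ * τ) x) := by
  have step : ∀ k : ℕ, I.PredLeSucc σ τ (((σ * τ)⁻¹ ^ k) x) := by
    intro k
    induction k with
    | zero => simpa using h
    | succ k ih =>
      have := (ih.inv_apply hτ).inv_apply hσ
      simpa [pow_succ', mul_inv_rev] using this
  obtain ⟨k, hk⟩ := (isOfFinOrder_of_finite (σ * τ)⁻¹).mem_powers_iff_mem_zpowers.2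
    (Subgroup.mem_zpowers_iff.2 ⟨-1, by rw [zpow_neg_one, inv_inv]⟩ :
      σ * τ ∈ Subgroup.zpowers (σ * τ)⁻¹)
  exact hk ▸ step k

lemma PredLeSucc.apply_right (hσ : IsStablePartition I σ) (hτ : IsStablePartition I τ) {x : Fin n}
    (h : I.PredLeSucc σ τ x) : I.PredLeSucc τ σ (τ x) := by
  simpa using (h.mul_apply hσ hτ).inv_apply hτ

variable (I) in
/-- Agent `x` strictly prefers its successor in each of `σ`, `τ` to its predecessor in the
other one. -/
def IsNeutral (σ τ : Equiv.Perm (Fin n)) (x : Fin n) : Prop :=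
  ¬ I.PredLeSucc σ τ x ∧ ¬ I.PredLeSucc τ σ x

lemma isNeutral_of_apply_eq (hσ : IsStablePartition I σ) (hτ : IsStablePartition I τ) {a : Fin n}
    (h : σ a = τ a) (h1 : σ (σ a) ≠ a) (h2 : τ (τ a) ≠ a) : I.IsNeutral σ τ a := by
  constructor
  · intro hS
    have hT := hS.apply_right hσ hτ
    have hb := hσ.1 (σ a)
    rw [PredLeSucc, Equiv.Perm.inv_def, Equiv.symm_apply_apply, ← h] at hT
    rw [Equiv.Perm.inv_def, Equiv.symm_apply_apply] at hb
    exact h1 (I.rank_injective _ (hb.antisymm hT))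
  · intro hT
    have hS := hT.apply_right hτ hσ
    have hb := hτ.1 (τ a)
    rw [PredLeSucc, Equiv.Perm.inv_def, Equiv.symm_apply_apply, h] at hS
    rw [Equiv.Perm.inv_def, Equiv.symm_apply_apply] at hb
    exact h2 (I.rank_injective _ (hb.antisymm hS))

lemma IsNeutral.of_apply (hσ : IsStablePartition I σ) (hτ : IsStablePartition I τ) {x : Fin n}
    (hx : σ (σ x) ≠ x) (h : I.IsNeutral σ τ (σ x)) : I.IsNeutral σ τ x ∧ τ x = σ x := by
  have hT : ¬ I.PredLeSucc τ σ x := fun hT => h.1 (hT.apply_right hτ hσ)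
  have heq : τ x = σ x := by
    have hle := rank_pred_le_of_lt hτ (not_le.1 hT)
    by_contra hne
    have hne' : τ⁻¹ (σ x) ≠ x := fun h' => hne (Equiv.Perm.inv_eq_iff_eq.1 h').symm
    have hlt := lt_of_le_of_ne hle fun h' => hne' (I.rank_injective _ h')
    have hS : I.PredLeSucc σ τ (τ⁻¹ (σ x)) := by
      simpa [PredLeSucc] using rank_pred_le_of_lt hσ (i := σ x) (j := τ⁻¹ (σ x)) (by simpa using hlt)
    exact h.2 (by simpa using hS.apply_right hσ hτ)
  refine ⟨⟨fun hS => hx ?_, hT⟩, heq⟩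
  rw [PredLeSucc, heq] at hS
  rw [I.rank_injective _ ((hσ.1 x).antisymm hS), Equiv.Perm.inv_def, Equiv.apply_symm_apply]

lemma apply_eq_of_sameCycle (hσ : IsStablePartition I σ) (hτ : IsStablePartition I τ) {a b : Fin n}
    (h : σ a = τ a) (h1 : σ (σ a) ≠ a) (h2 : τ (τ a) ≠ a) (hab : σ.SameCycle a b) :
    τ b = σ b := by
  have long : ∀ k : ℕ, σ (σ ((σ⁻¹ ^ k) a)) ≠ (σ⁻¹ ^ k) a := by
    intro k hk
    apply h1
    apply (σ⁻¹ ^ k).injective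
    have e : ∀ x, (σ⁻¹ ^ k) (σ x) = σ ((σ⁻¹ ^ k) x) := fun x => by
      rw [← Equiv.Perm.mul_apply, ← Equiv.Perm.mul_apply,
        ((Commute.refl σ).inv_left.pow_left k).eq]
    rw [e, e, hk]
  have neutral : ∀ k : ℕ, I.IsNeutral σ τ ((σ⁻¹ ^ k) a) := by
    intro k
    induction k with
    | zero => simpa using isNeutral_of_apply_eq hσ hτ h h1 h2
    | succ k ih =>
      refine (IsNeutral.of_apply hσ hτ (long _) ?_).1
      simpa [pow_succ'] using ih
  obtain ⟨k, -, -, hk⟩ := (Equiv.Perm.sameCycle_inv.2 hab).exists_pow_eq _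
  rcases k with _ | k
  · simpa [← hk] using h.symm
  · rw [← hk]
    refine (IsNeutral.of_apply hσ hτ (long _) ?_).2
    simpa [pow_succ'] using neutral k

end SRInstance

lemma cycleAt_eq_of_sameCycle {σ : Equiv.Perm (Fin n)} {a b : Fin n} (h : σ.SameCycle a b) :
    cycleAt σ a = cycleAt σ b := by
  refine Prod.ext ?_ h.cycleOf_eq
  ext x
  simp only [cycleAt, orbitOf, Finset.mem_filter, Finset.mem_univ, true_and]
  exact ⟨h.symm.trans, h.trans⟩

lemma cycleAt_congr {σ τ : Equiv.Perm (Fin n)} {a : Fin n}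
    (h : ∀ b, σ.SameCycle a b → τ b = σ b) : cycleAt σ a = cycleAt τ a := by
  have hpow : ∀ k : ℕ, (τ ^ k) a = (σ ^ k) a := by
    intro k
    induction k with
    | zero => simp
    | succ k ih =>
      rw [pow_succ', pow_succ', Equiv.Perm.mul_apply, Equiv.Perm.mul_apply, ih]
      exact h _ ⟨k, by simp⟩
  have hiff : ∀ b, σ.SameCycle a b ↔ τ.SameCycle a b := by
    intro b
    constructor <;> intro hb <;> obtain ⟨k, -, -, hk⟩ := hb.exists_pow_eq _ <;>
      exact ⟨k, by simp [← hk, hpow]⟩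
  refine Prod.ext ?_ ?_
  · ext b
    simp [cycleAt, orbitOf, hiff]
  · ext b
    simp only [cycleAt, Equiv.Perm.cycleOf_apply]
    by_cases hb : σ.SameCycle a b
    · simp [hb, (hiff b).1 hb, h b hb]
    · simp [hb, (hiff b).not.1 hb]

lemma cycleAt_eq_of_apply_apply {σ τ : Equiv.Perm (Fin n)} {a : Fin n} (h : σ a = τ a)
    (h1 : σ (σ a) = a) (h2 : τ (τ a) = a) : cycleAt σ a = cycleAt τ a := by
  refine cycleAt_congr fun b hb => ?_
  have hpow : ∀ k : ℕ, (σ ^ k) a = a ∨ (σ ^ k) a = σ a := by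
    intro k
    induction k with
    | zero => simp
    | succ k ih =>
      rw [pow_succ', Equiv.Perm.mul_apply]
      rcases ih with ih | ih <;> simp [ih, h1]
  obtain ⟨k, -, -, rfl⟩ := hb.exists_pow_eq _
  rcases hpow k with hk | hk <;> rw [hk]
  · exact h.symm
  · rw [h1, h, h2]

/-- The pair `(p, q)` encodes the cycle `c`: an increasing pair encodes a cycle of length at
least three, the other pairs encode fixed points and transpositions. -/
def Encodes (I : SRInstance n) (c : Finset (Fin n) × Equiv.Perm (Fin n))
    (p q : Fin n) : Prop :=
  ∃ σ, IsStablePartition I σ ∧ cycleAt σ p = c ∧ σ p = q ∧ (σ q ≠ p ↔ p < q)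

lemma Encodes.unique {I : SRInstance n} {c d : Finset (Fin n) × Equiv.Perm (Fin n)} {p q : Fin n}
    (hc : Encodes I c p q) (hd : Encodes I d p q) : c = d := by
  obtain ⟨σ, hσ, rfl, rfl, hσ'⟩ := hc
  obtain ⟨τ, hτ, rfl, h, hτ'⟩ := hd
  by_cases hlt : p < σ p
  · exact cycleAt_congr fun b hb => SRInstance.apply_eq_of_sameCycle hσ hτ h.symm (hσ'.2 hlt)
      (by simpa [h] using hτ'.2 hlt) hb
  · exact cycleAt_eq_of_apply_apply h.symm (not_not.1 fun h' => hlt (hσ'.1 h'))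
      (not_not.1 fun h' => hlt (hτ'.1 (by simpa [h] using h')))

lemma exists_encodes {I : SRInstance n} {c : Finset (Fin n) × Equiv.Perm (Fin n)}
    (hc : c ∈ stableCycles I) : ∃ p : Fin n × Fin n, Encodes I c p.1 p.2 := by
  obtain ⟨σ, a, hσ, rfl⟩ := hc
  obtain ⟨m, hm, hmin⟩ := (orbitOf σ a).exists_min_image id ⟨a, by simp [orbitOf, Equiv.Perm.SameCycle.refl]⟩
  simp only [orbitOf, Finset.mem_filter, Finset.mem_univ, true_and, id] at hm hmin
  have hle : m ≤ σ m := hmin _ (Equiv.Perm.sameCycle_apply_right.2 hm)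
  by_cases h : σ (σ m) = m
  · exact ⟨(σ m, m), σ, hσ,
      (cycleAt_eq_of_sameCycle (Equiv.Perm.sameCycle_apply_right.2 hm)).symm, h,
      by simpa using hle⟩
  · refine ⟨(m, σ m), σ, hσ, (cycleAt_eq_of_sameCycle hm).symm, rfl, ?_⟩
    refine iff_of_true h (lt_of_le_of_ne hle fun heq => h ?_)
    exact (congrArg σ heq).symm.trans heq.symm

/-- For an SR instance with `n ≥ 2` agents,
`|SC(I)| ≤ 3 (n(n-1)/2 + 1)`; in particular the number of stable cycles is O(n²). -/
theorem stable_cycles_quadratic_bound {n : ℕ} (hn : 2 ≤ n) (I : SRInstance n) :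
    (stableCycles I).ncard ≤ 3 * (n * (n - 1) / 2 + 1) := by
  have : Nonempty (Fin n × Fin n) := ⟨⟨0, by omega⟩, ⟨0, by omega⟩⟩
  choose! f hf using fun c (hc : c ∈ stableCycles I) => exists_encodes hc
  have hcard : (stableCycles I).ncard ≤ n * n := by
    have := Set.ncard_le_ncard_of_injOn (t := Set.univ) f (fun _ _ => Set.mem_univ _)
      (fun c hc d hd h => (hf c hc).unique (h ▸ hf d hd)) Set.finite_univ
    simpa [Set.ncard_univ] using this
  obtain ⟨m, rfl⟩ := Nat.exists_eq_add_of_le hn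
  have heven : 2 ∣ (2 + m) * (2 + m - 1) := (Nat.even_mul_pred_self _).two_dvd
  obtain ⟨k, hk⟩ := heven
  rw [hk, Nat.mul_div_cancel_left _ two_pos]
  have : 2 + m - 1 = m + 1 := by omega
  rw [this] at hk
  nlinarith
end
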